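/- Let R = ℚ[x, y, z] and let I = (x(y³ − z³), y(z³ − x³), z(x³ − y³)). Then the Waldschmidt constant of I equals 3, i.e., lim_{m→∞} α(I^(m))/m = 3. -/

import Mathlib

/-- The `n`-th symbolic power of an ideal `I`: the intersection, over the associated
primes `P` of `R/I`, of the contractions of `IⁿR_P` along the localization maps. -/
noncomputable def symbolicPower {R : Type*} [CommRing R] (I : Ideal R) (n : ℕ) : Ideal R :=
  ⨅ (P : Ideal R) (hP : IsAssociatedPrime P (R ⧸ I)),
    letI := hP.isPrime
    Ideal.comap (algebraMap R (Localization.AtPrime P))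
      (Ideal.map (algebraMap R (Localization.AtPrime P)) (I ^ n))

/-- The initial degree `α(J)` of a homogeneous ideal: the smallest `d` with `J_d ≠ 0`,
i.e. the least degree of a nonzero homogeneous element of `J`. -/
noncomputable def initialDegree {k : Type*} [CommSemiring k] {N : ℕ}
    (J : Ideal (MvPolynomial (Fin N) k)) : ℕ :=
  sInf {d : ℕ | ∃ f ∈ J, f ≠ 0 ∧ MvPolynomial.IsHomogeneous f d}

open MvPolynomial in
/-- The ideal `(x(y³ − z³), y(z³ − x³), z(x³ − y³))` of `ℚ[x, y, z]`. -/
noncomputable def fermatIdeal : Ideal (MvPolynomial (Fin 3) ℚ) :=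
  Ideal.span {X 0 * (X 1 ^ 3 - X 2 ^ 3), X 1 * (X 2 ^ 3 - X 0 ^ 3),
    X 2 * (X 0 ^ 3 - X 1 ^ 3)}

open MvPolynomial

section Symbolic

theorem mem_symbolicPower_iff {R : Type*} [CommRing R] {I : Ideal R} {n : ℕ} {f : R} :
    f ∈ symbolicPower I n ↔
      ∀ P : Ideal R, IsAssociatedPrime P (R ⧸ I) → ∃ s ∉ P, s * f ∈ I ^ n := by
  simp only [symbolicPower, Ideal.mem_iInf, Ideal.mem_comap]
  refine forall₂_congr fun P hP => ?_
  have := hP.isPrime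
  rw [IsLocalization.algebraMap_mem_map_algebraMap_iff P.primeCompl]
  rfl

theorem symbolicPower_anti {R : Type*} [CommRing R] (I : Ideal R) {m n : ℕ} (h : m ≤ n) :
    symbolicPower I n ≤ symbolicPower I m := by
  intro f hf
  rw [mem_symbolicPower_iff] at hf ⊢
  intro P hP
  obtain ⟨s, hs, hsf⟩ := hf P hP
  exact ⟨s, hs, Ideal.pow_le_pow_right h hsf⟩

theorem IsAssociatedPrime.le_of_quotient {R : Type*} [CommRing R] {I P : Ideal R}
    (hP : IsAssociatedPrime P (R ⧸ I)) : I ≤ P := by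
  have h := hP.annihilator_le
  rwa [Submodule.annihilator_top, Ideal.annihilator_quotient] at h

end Symbolic

section Primes

variable {R : Type*} [CommRing R] {I P : Ideal R} [P.IsPrime] {x y z : R}

theorem cube_mem_or_cube_sub_cube_mem (ha : x * (y ^ 3 - z ^ 3) ∈ P)
    (hb : y * (z ^ 3 - x ^ 3) ∈ P) (hz : z ∉ P) :
    (x ∈ P ∧ y ∈ P) ∨ (x ∉ P ∧ y ∉ P ∧ x ^ 3 - z ^ 3 ∈ P ∧ y ^ 3 - z ^ 3 ∈ P) := by
  have hP : P.IsPrime := inferInstance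
  have key : ∀ {u : R}, u ∈ P → u ^ 3 - z ^ 3 ∉ P := fun {u} hu h => by
    refine hz (hP.mem_of_pow_mem 3 ?_)
    have := P.sub_mem (P.pow_mem_of_mem hu 3 (by norm_num)) h
    rwa [sub_sub_cancel] at this
  by_cases hx : x ∈ P
  · refine Or.inl ⟨hx, (hP.mem_or_mem hb).resolve_right fun h => key hx ?_⟩
    rwa [← P.neg_mem_iff, neg_sub]
  · have hyz := (hP.mem_or_mem ha).resolve_left hx
    have hy : y ∉ P := fun h => key h hyz
    refine Or.inr ⟨hx, hy, ?_, hyz⟩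
    rw [← P.neg_mem_iff, neg_sub]
    exact (hP.mem_or_mem hb).resolve_left hy

theorem exists_notMem_mul_mem_pow_three (hIP : I ≤ P) (ha : x * (y ^ 3 - z ^ 3) ∈ I)
    (hb : y * (z ^ 3 - x ^ 3) ∈ I) (hc : z * (x ^ 3 - y ^ 3) ∈ I) (hz : z ∉ P) :
    ∃ s ∉ P, s * ((x ^ 3 - y ^ 3) * (y ^ 3 - z ^ 3) * (z ^ 3 - x ^ 3)) ∈ I ^ 3 := by
  have hP : P.IsPrime := inferInstance
  rcases cube_mem_or_cube_sub_cube_mem (hIP ha) (hIP hb) hz with ⟨hx, hy⟩ | ⟨hx, hy, -, -⟩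
  · refine ⟨(y ^ 3 - z ^ 3) ^ 2 * (z ^ 3 - x ^ 3) ^ 2, ?_, ?_⟩
    · have hx3 := P.pow_mem_of_mem hx 3 (by norm_num)
      have hy3 := P.pow_mem_of_mem hy 3 (by norm_num)
      have hz3 : z ^ 3 ∉ P := fun h => hz (hP.mem_of_pow_mem 3 h)
      refine hP.mul_notMem (fun h => hz3 ?_) (fun h => hz3 ?_)
      · simpa using P.sub_mem hy3 (hP.mem_of_pow_mem 2 h)
      · simpa using P.add_mem hx3 (hP.mem_of_pow_mem 2 h)
    · have h := (I ^ 3).sub_mem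
        ((I ^ 3).mul_mem_left ((z ^ 3 - x ^ 3) ^ 3) (Ideal.pow_mem_pow ha 3))
        ((I ^ 3).mul_mem_left ((y ^ 3 - z ^ 3) ^ 3) (Ideal.pow_mem_pow hb 3))
      convert h using 1
      ring
  · refine ⟨x * y * z, hP.mul_notMem (hP.mul_notMem hx hy) hz, ?_⟩
    have h := Ideal.mul_mem_mul (Ideal.mul_mem_mul ha hb) hc
    rw [pow_succ, pow_two]
    convert h using 1
    ring

end Primes

section Saturation

theorem sub_aeval_mem {σ K : Type*} [CommRing K] (J : Ideal (MvPolynomial σ K))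
    (g : σ → MvPolynomial σ K) (h : ∀ i, X i - g i ∈ J) (F : MvPolynomial σ K) :
    F - aeval g F ∈ J := by
  have : (Ideal.Quotient.mkₐ K J) = (Ideal.Quotient.mkₐ K J).comp (aeval g) := by
    ext i
    simpa [Ideal.Quotient.eq] using h i
  simpa [Ideal.Quotient.eq] using DFunLike.congr_fun this F

theorem degreeOf_eq_zero_of_dvd {σ K : Type*} [Field K] {f g : MvPolynomial σ K} (h : f ∣ g)
    (hg : g ≠ 0) {i : σ} (hi : degreeOf i g = 0) : degreeOf i f = 0 := by
  obtain ⟨r, rfl⟩ := h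
  rw [degreeOf_mul_eq (left_ne_zero_of_mul hg) (right_ne_zero_of_mul hg)] at hi
  lia

theorem not_X_dvd_of_eval_ne_zero {σ K : Type*} [Field K] {i : σ} {F : MvPolynomial σ K} (g : σ → K)
    (hg : g i = 0) (hF : eval g F ≠ 0) : ¬ X i ∣ F := by
  rintro ⟨r, rfl⟩
  simp [hg] at hF

theorem isRelPrime_cube_sub_cube :
    IsRelPrime (X 1 ^ 3 - X 2 ^ 3 : MvPolynomial (Fin 3) ℚ) (X 2 ^ 3 - X 0 ^ 3) := by
  intro d h1 h2
  have hne : (X 1 ^ 3 - X 2 ^ 3 : MvPolynomial (Fin 3) ℚ) ≠ 0 := fun h => by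
    simpa using congrArg (eval ![0, 1, 0]) h
  have hdeg : degreeOf 0 (X 1 ^ 3 - X 2 ^ 3 : MvPolynomial (Fin 3) ℚ) = 0 := by
    have := degreeOf_sub_le 0 (X 1 ^ 3 : MvPolynomial (Fin 3) ℚ) (X 2 ^ 3)
    have h1 := degreeOf_pow_le 0 (X 1 : MvPolynomial (Fin 3) ℚ) 3
    have h2 := degreeOf_pow_le 0 (X 2 : MvPolynomial (Fin 3) ℚ) 3
    rw [degreeOf_X_of_ne (by decide)] at h1 h2
    lia
  have hd := degreeOf_eq_zero_of_dvd h1 hne hdeg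
  have hvars : (0 : Fin 3) ∉ d.vars := by
    rwa [mem_vars_iff_degreeOf_ne_zero, not_not]
  have key : ∀ c : MvPolynomial (Fin 3) ℚ, bind₁ ![c, X 1, X 2] d = d := fun c => by
    rw [← aeval_eq_bind₁]
    conv_rhs => rw [← aeval_X_left_apply d]
    refine eval₂Hom_congr' rfl (fun i hi _ => ?_) rfl
    fin_cases i
    · exact absurd hi hvars
    · simp
    · simp
  have h3 : d ∣ X 2 ^ 3 := by
    simpa [key] using map_dvd (aeval (R := ℚ) ![(0 : MvPolynomial (Fin 3) ℚ), X 1, X 2]) h2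
  have h4 : d ∣ X 2 ^ 3 - 1 := by
    simpa [key] using map_dvd (aeval (R := ℚ) ![(1 : MvPolynomial (Fin 3) ℚ), X 1, X 2]) h2
  exact isUnit_of_dvd_one (by simpa using dvd_sub h3 h4)

theorem exists_of_syzygy {α β γ : MvPolynomial (Fin 3) ℚ}
    (h : α * (X 0 * (X 1 ^ 3 - X 2 ^ 3)) + β * (X 1 * (X 2 ^ 3 - X 0 ^ 3)) +
      γ * (X 2 * (X 0 ^ 3 - X 1 ^ 3)) = 0) :
    ∃ s t : MvPolynomial (Fin 3) ℚ, α = s * (X 1 * X 2) + t * X 0 ^ 2 ∧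
      β = s * (X 0 * X 2) + t * X 1 ^ 2 ∧ γ = s * (X 0 * X 1) + t * X 2 ^ 2 := by
  have hX : ∀ i : Fin 3, (X i : MvPolynomial (Fin 3) ℚ) ≠ 0 := X_ne_zero
  have h21 : ¬ (X 2 : MvPolynomial (Fin 3) ℚ) ∣ X 1 :=
    not_X_dvd_of_eval_ne_zero ![0, 1, 0] (by simp) (by simp)
  have h12 : ¬ (X 1 : MvPolynomial (Fin 3) ℚ) ∣ X 2 :=
    not_X_dvd_of_eval_ne_zero ![0, 0, 1] (by simp) (by simp)
  have hsub : ∀ F : MvPolynomial (Fin 3) ℚ, X 0 ∣ F - aeval ![0, X 1, X 2] F := fun F =>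
    Ideal.mem_span_singleton.1 (sub_aeval_mem (Ideal.span {X 0}) ![0, X 1, X 2] (fun i => by
      fin_cases i <;> simp) F)
  obtain ⟨β₁, hβ₁⟩ := hsub β
  obtain ⟨γ₁, hγ₁⟩ := hsub γ
  generalize hβ₀ : aeval (R := ℚ) ![(0 : MvPolynomial (Fin 3) ℚ), X 1, X 2] β = β₀ at hβ₁
  generalize hγ₀ : aeval (R := ℚ) ![(0 : MvPolynomial (Fin 3) ℚ), X 1, X 2] γ = γ₀ at hγ₁
  have h0 : β₀ * X 2 ^ 2 = γ₀ * X 1 ^ 2 := by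
    have := congrArg (aeval (R := ℚ) ![(0 : MvPolynomial (Fin 3) ℚ), X 1, X 2]) h
    simp only [map_add, map_mul, hβ₀, hγ₀] at this
    simp only [map_sub, map_pow, map_zero, aeval_X, Matrix.cons_val] at this
    refine mul_left_cancel₀ (mul_ne_zero (hX 1) (hX 2)) ?_
    linear_combination this
  obtain ⟨t, rfl⟩ : X 1 ^ 2 ∣ β₀ :=
    (X_prime (i := (1 : Fin 3))).pow_dvd_of_dvd_mul_right 2
      (mt (X_prime (i := (1 : Fin 3))).dvd_of_dvd_pow h12) ⟨γ₀, h0.trans (mul_comm _ _)⟩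
  obtain rfl : γ₀ = X 2 ^ 2 * t :=
    mul_left_cancel₀ (pow_ne_zero 2 (hX 1)) (by linear_combination -h0)
  obtain rfl : β = X 1 ^ 2 * t + X 0 * β₁ := by linear_combination hβ₁
  obtain rfl : γ = X 2 ^ 2 * t + X 0 * γ₁ := by linear_combination hγ₁
  obtain ⟨e, he⟩ : X 1 ^ 3 - X 2 ^ 3 ∣ β₁ * X 1 - γ₁ * X 2 := by
    refine isRelPrime_cube_sub_cube.dvd_of_dvd_mul_left
      ⟨γ₁ * X 2 - α + t * X 0 ^ 2, mul_left_cancel₀ (hX 0) ?_⟩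
    linear_combination h
  obtain ⟨s, hs⟩ : X 2 ∣ β₁ - e * X 1 ^ 2 :=
    ((X_prime (i := (2 : Fin 3))).dvd_or_dvd (b := X 1) ⟨γ₁ - e * X 2 ^ 2, by
      linear_combination he⟩).resolve_right h21
  have hs' : γ₁ - e * X 2 ^ 2 = X 1 * s := mul_left_cancel₀ (hX 2) (by
    linear_combination X 1 * hs - he)
  have hne : (X 1 ^ 3 - X 2 ^ 3 : MvPolynomial (Fin 3) ℚ) ≠ 0 := fun h => by
    simpa using congrArg (eval ![0, 1, 0]) h
  refine ⟨s, X 0 * e + t, mul_right_cancel₀ (mul_ne_zero (hX 0) hne) ?_, ?_, ?_⟩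
  · linear_combination h - X 0 * X 1 * (X 2 ^ 3 - X 0 ^ 3) * hs -
      X 0 * X 2 * (X 0 ^ 3 - X 1 ^ 3) * hs'
  · linear_combination X 0 * hs
  · linear_combination X 0 * hs'

theorem mem_fermatIdeal_iff {f : MvPolynomial (Fin 3) ℚ} :
    f ∈ fermatIdeal ↔ ∃ a b c, a * (X 0 * (X 1 ^ 3 - X 2 ^ 3)) +
      b * (X 1 * (X 2 ^ 3 - X 0 ^ 3)) + c * (X 2 * (X 0 ^ 3 - X 1 ^ 3)) = f := by
  simp only [fermatIdeal, Ideal.mem_span_insert, Ideal.mem_span_singleton']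
  constructor
  · rintro ⟨a, _, ⟨b, _, ⟨c, rfl⟩, rfl⟩, rfl⟩
    exact ⟨a, b, c, by ring⟩
  · rintro ⟨a, b, c, rfl⟩
    exact ⟨a, _, ⟨b, _, ⟨c, rfl⟩, rfl⟩, by ring⟩

theorem mem_fermatIdeal_of_mul_mem {g : MvPolynomial (Fin 3) ℚ}
    (hz : X 2 * g ∈ fermatIdeal) (hl : (X 1 - 2 * X 0) * g ∈ fermatIdeal) :
    g ∈ fermatIdeal := by
  rw [mem_fermatIdeal_iff] at hz hl ⊢
  obtain ⟨p₁, p₂, p₃, hp⟩ := hz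
  obtain ⟨q₁, q₂, q₃, hq⟩ := hl
  have hX : ∀ i : Fin 3, (X i : MvPolynomial (Fin 3) ℚ) ≠ 0 := X_ne_zero
  set l : MvPolynomial (Fin 3) ℚ := X 1 - 2 * X 0 with hl
  obtain ⟨s, t, h1, h2, h3⟩ := exists_of_syzygy (α := l * p₁ - X 2 * q₁)
    (β := l * p₂ - X 2 * q₂) (γ := l * p₃ - X 2 * q₃) (by
      linear_combination l * hp - X 2 * hq)
  let e : MvPolynomial (Fin 3) ℚ →ₐ[ℚ] MvPolynomial (Fin 3) ℚ := aeval ![X 0, 2 * X 0, 0]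
  have hsub : ∀ F, e F = 0 → ∃ a b, F = a * X 2 + b * l := by
    intro F hF
    have := sub_aeval_mem (Ideal.span {X 2, l}) ![X 0, 2 * X 0, 0] (fun i => by
      fin_cases i
      · simp
      · exact Ideal.subset_span (by simp [hl])
      · exact Ideal.subset_span (by simp)) F
    change F - e F ∈ _ at this
    rw [hF, sub_zero, Ideal.mem_span_pair] at this
    obtain ⟨a, b, h⟩ := this
    exact ⟨a, b, h.symm⟩
  have e0 : e (X 0) = X 0 := by simp [e]
  have e1 : e (X 1) = 2 * X 0 := by simp [e]
  have e2 : e (X 2) = 0 := by simp [e]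
  have el : e l = 0 := by simp [hl, e0, e1, map_ofNat]
  obtain ⟨t₁, t₂, ht⟩ := hsub t (by
    have := congrArg e h1
    simpa [e0, e1, e2, el, hX] using this)
  obtain ⟨s₁, s₂, hs⟩ := hsub s (by
    have := congrArg e h3
    simpa [e0, e1, e2, el, hX] using this)
  have hdvd : ¬ X 2 ∣ l := not_X_dvd_of_eval_ne_zero ![0, 1, 0] (by simp) (by simp [hl])
  have key : ∀ p q u v : MvPolynomial (Fin 3) ℚ, l * p - X 2 * q = s * u + t * v →
      ∃ r, p = X 2 * r + s₂ * u + t₂ * v := by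
    intro p q u v h
    obtain ⟨r, hr⟩ : X 2 ∣ p - s₂ * u - t₂ * v :=
      ((X_prime (i := (2 : Fin 3))).dvd_or_dvd (a := l) ⟨q + s₁ * u + t₁ * v, by
        rw [hs, ht] at h
        linear_combination h⟩).resolve_left hdvd
    exact ⟨r, by linear_combination hr⟩
  obtain ⟨r₁, hr₁⟩ := key _ _ _ _ h1
  obtain ⟨r₂, hr₂⟩ := key _ _ _ _ h2
  obtain ⟨r₃, hr₃⟩ := key _ _ _ _ h3
  refine ⟨r₁, r₂, r₃, mul_left_cancel₀ (hX 2) ?_⟩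
  rw [hr₁, hr₂, hr₃] at hp
  linear_combination hp

theorem exists_X_notMem_of_isAssociatedPrime {P : Ideal (MvPolynomial (Fin 3) ℚ)}
    (hP : IsAssociatedPrime P (MvPolynomial (Fin 3) ℚ ⧸ fermatIdeal)) : ∃ i, X i ∉ P := by
  by_contra! h
  obtain ⟨hprime, x, hx⟩ := isAssociatedPrime_iff.1 hP
  obtain ⟨g, rfl⟩ := Ideal.Quotient.mk_surjective x
  have hmem : ∀ f, f ∈ P ↔ f * g ∈ fermatIdeal := fun f => by
    rw [hx, Submodule.mem_colon_singleton, ← Ideal.Quotient.eq_zero_iff_mem]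
    rfl
  have hg := mem_fermatIdeal_of_mul_mem ((hmem _).1 (h 2))
    ((hmem _).1 (P.sub_mem (h 1) (P.mul_mem_left 2 (h 0))))
  exact hprime.one_notMem ((hmem 1).2 (by simpa using hg))

theorem fermatIdeal_generators_mem :
    (X 0 * (X 1 ^ 3 - X 2 ^ 3) ∈ fermatIdeal ∧ X 1 * (X 2 ^ 3 - X 0 ^ 3) ∈ fermatIdeal) ∧
      X 2 * (X 0 ^ 3 - X 1 ^ 3) ∈ fermatIdeal :=
  ⟨⟨Ideal.subset_span (by simp), Ideal.subset_span (by simp)⟩, Ideal.subset_span (by simp)⟩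

/-- The product of the nine lines of the dual Hesse arrangement. -/
noncomputable def nineLines (K : Type*) [CommRing K] : MvPolynomial (Fin 3) K :=
  (X 0 ^ 3 - X 1 ^ 3) * (X 1 ^ 3 - X 2 ^ 3) * (X 2 ^ 3 - X 0 ^ 3)

theorem nineLines_pow_mem_symbolicPower (k : ℕ) :
    nineLines ℚ ^ k ∈ symbolicPower fermatIdeal (3 * k) := by
  rw [mem_symbolicPower_iff]
  intro P hP
  have := hP.isPrime
  obtain ⟨i, hi⟩ := exists_X_notMem_of_isAssociatedPrime hP
  have hle := hP.le_of_quotient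
  obtain ⟨⟨ha, hb⟩, hc⟩ := fermatIdeal_generators_mem
  obtain ⟨s, hs, hmem⟩ : ∃ s ∉ P, s * nineLines ℚ ∈ fermatIdeal ^ 3 := by
    unfold nineLines
    fin_cases i
    · convert exists_notMem_mul_mem_pow_three hle hb hc ha hi using 4
      ring
    · convert exists_notMem_mul_mem_pow_three hle hc ha hb hi using 4
      ring
    · exact exists_notMem_mul_mem_pow_three hle ha hb hc hi
  refine ⟨s ^ k, fun h => hs (hP.isPrime.mem_of_pow_mem k h), ?_⟩
  rw [← mul_pow, pow_mul]
  exact Ideal.pow_mem_pow hmem k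

end Saturation

section Points

/-- The points of `ℂ³` other than the origin at which the Fermat ideal vanishes. -/
structure IsFermatPoint (p : Fin 3 → ℂ) : Prop where
  ne_zero : p ≠ 0
  eq_zero₀ : p 0 * (p 1 ^ 3 - p 2 ^ 3) = 0
  eq_zero₁ : p 1 * (p 2 ^ 3 - p 0 ^ 3) = 0
  eq_zero₂ : p 2 * (p 0 ^ 3 - p 1 ^ 3) = 0

/-- The coordinate ring of the family of arcs through the points of a line: `X none` is the
parameter along the line, and the `X (some i)` are the coordinates of a generic direction. -/
abbrev ArcRing : Type := MvPolynomial (Option (Fin 3)) ℂ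

/-- The restriction of polynomials to the line through `p`. -/
noncomputable def restrictLine (p : Fin 3 → ℂ) : MvPolynomial (Fin 3) ℂ →ₐ[ℂ] ArcRing :=
  aeval fun i => C (p i) * X none

/-- The expansion of polynomials along a generic arc through a generic point of the line
through `p`. The order of the result in the polynomial variable is the order of vanishing
along this line. -/
noncomputable def germ (p : Fin 3 → ℂ) :
    MvPolynomial (Fin 3) ℂ →ₐ[ℂ] Polynomial ArcRing :=
  aeval fun i => Polynomial.C (C (p i) * X none) + Polynomial.X * Polynomial.C (X (some i))

theorem germ_X (p : Fin 3 → ℂ) (i : Fin 3) : germ p (X i) =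
    Polynomial.C (C (p i) * X none) + Polynomial.X * Polynomial.C (X (some i)) :=
  aeval_X _ _

theorem coeff_zero_germ (p : Fin 3 → ℂ) (F : MvPolynomial (Fin 3) ℂ) :
    (germ p F).coeff 0 = restrictLine p F := by
  have : Polynomial.constantCoeff.comp (germ p).toRingHom = (restrictLine p).toRingHom := by
    refine MvPolynomial.ringHom_ext (fun r => ?_) (fun i => ?_)
    · simp [germ, restrictLine, Polynomial.algebraMap_apply, MvPolynomial.algebraMap_eq]
    · simp [germ, restrictLine]
  exact DFunLike.congr_fun this F

/-- The homogeneous prime ideal of the line through `p`. -/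
noncomputable def lineIdeal (p : Fin 3 → ℂ) : Ideal (MvPolynomial (Fin 3) ℚ) :=
  RingHom.ker ((restrictLine p).toRingHom.comp (map (algebraMap ℚ ℂ)))

instance (p : Fin 3 → ℂ) : (lineIdeal p).IsPrime := RingHom.ker_isPrime _

theorem mem_lineIdeal {p : Fin 3 → ℂ} {f : MvPolynomial (Fin 3) ℚ} :
    f ∈ lineIdeal p ↔ restrictLine p (map (algebraMap ℚ ℂ) f) = 0 :=
  RingHom.mem_ker

theorem fermatIdeal_le_lineIdeal {p : Fin 3 → ℂ} (hp : IsFermatPoint p) :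
    fermatIdeal ≤ lineIdeal p := by
  have key : ∀ i j k, p i * (p j ^ 3 - p k ^ 3) = 0 →
      X i * (X j ^ 3 - X k ^ 3) ∈ lineIdeal p := fun i j k h => by
    have h' := congrArg (C : ℂ → ArcRing) h
    simp only [C_mul, C_sub, C_pow, C_0] at h'
    simp only [mem_lineIdeal, restrictLine, map_mul, map_sub, map_pow, map_X, aeval_X]
    linear_combination X none ^ 4 * h'
  rw [fermatIdeal, Ideal.span_le]
  rintro f (rfl | rfl | rfl)
  exacts [key _ _ _ hp.eq_zero₀, key _ _ _ hp.eq_zero₁, key _ _ _ hp.eq_zero₂]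

theorem exists_cube_sub_mem {Q : Ideal (MvPolynomial (Fin 3) ℚ)} [Q.IsPrime]
    (hQ : fermatIdeal ≤ Q) {i : Fin 3} (hi : X i ∉ Q) (j : Fin 3) :
    ∃ ε : ℚ, X j ^ 3 - C ε * X i ^ 3 ∈ Q := by
  obtain ⟨⟨ha, hb⟩, hc⟩ := fermatIdeal_generators_mem
  have key : ∀ {x y z : MvPolynomial (Fin 3) ℚ}, x * (y ^ 3 - z ^ 3) ∈ fermatIdeal →
      y * (z ^ 3 - x ^ 3) ∈ fermatIdeal → z ∉ Q → (∃ ε : ℚ, x ^ 3 - C ε * z ^ 3 ∈ Q) ∧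
      (∃ ε : ℚ, y ^ 3 - C ε * z ^ 3 ∈ Q) ∧ ∃ ε : ℚ, z ^ 3 - C ε * z ^ 3 ∈ Q := by
    intro x y z ha hb hz
    refine ⟨?_, ?_, 1, by simp⟩ <;>
    rcases cube_mem_or_cube_sub_cube_mem (hQ ha) (hQ hb) hz with ⟨hx, hy⟩ | ⟨-, -, hx, hy⟩
    · exact ⟨0, by simpa using Q.pow_mem_of_mem hx 3 (by norm_num)⟩
    · exact ⟨1, by simpa using hx⟩
    · exact ⟨0, by simpa using Q.pow_mem_of_mem hy 3 (by norm_num)⟩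
    · exact ⟨1, by simpa using hy⟩
  fin_cases i
  · obtain ⟨h1, h2, h0⟩ := key hb hc hi
    fin_cases j <;> assumption
  · obtain ⟨h1, h2, h0⟩ := key hc ha hi
    fin_cases j <;> assumption
  · obtain ⟨h1, h2, h0⟩ := key ha hb hi
    fin_cases j <;> assumption

theorem lineIdeal_le_of_le {p : Fin 3 → ℂ} (hp : p ≠ 0)
    {Q : Ideal (MvPolynomial (Fin 3) ℚ)} [Q.IsPrime] (hQ : fermatIdeal ≤ Q)
    (hle : Q ≤ lineIdeal p) : lineIdeal p ≤ Q := by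
  obtain ⟨i, hi⟩ := Function.ne_iff.1 hp
  have hXi : X i ∉ lineIdeal p := by
    rw [mem_lineIdeal, map_X, restrictLine, aeval_X]
    exact mul_ne_zero (C_ne_zero.2 hi) (X_ne_zero _)
  let _ : Algebra (Polynomial ℚ) (MvPolynomial (Fin 3) ℚ ⧸ Q) :=
    ((Ideal.Quotient.mk Q).comp
      (Polynomial.aeval (X i : MvPolynomial (Fin 3) ℚ)).toRingHom).toAlgebra
  have halg : ∀ h : Polynomial ℚ, algebraMap (Polynomial ℚ) (MvPolynomial (Fin 3) ℚ ⧸ Q) h =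
      Ideal.Quotient.mk Q (Polynomial.aeval (X i) h) := fun _ => rfl
  have hintegral : ∀ f, IsIntegral (Polynomial ℚ) (Ideal.Quotient.mk Q f) := by
    intro f
    induction f using MvPolynomial.induction_on with
    | C a =>
      have := isIntegral_algebraMap (R := Polynomial ℚ) (A := MvPolynomial (Fin 3) ℚ ⧸ Q)
        (x := Polynomial.C a)
      rwa [halg, Polynomial.aeval_C] at this
    | add f g hf hg => simpa using hf.add hg
    | mul_X f j hf =>
      rw [map_mul]
      refine hf.mul (IsIntegral.of_pow (n := 3) (by norm_num) ?_)
      obtain ⟨ε, hε⟩ := exists_cube_sub_mem hQ (fun h => hXi (hle h)) j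
      have := isIntegral_algebraMap (R := Polynomial ℚ) (A := MvPolynomial (Fin 3) ℚ ⧸ Q)
        (x := Polynomial.C ε * Polynomial.X ^ 3)
      rw [halg, map_mul, map_pow, Polynomial.aeval_C, Polynomial.aeval_X] at this
      rw [← map_pow, Ideal.Quotient.eq.2 hε]
      exact this
  intro f hf
  by_contra hfQ
  have hlt := Ideal.comap_lt_comap_of_integral_mem_sdiff (R := Polynomial ℚ)
    (I := (⊥ : Ideal (MvPolynomial (Fin 3) ℚ ⧸ Q)))
    (J := (lineIdeal p).map (Ideal.Quotient.mk Q)) bot_le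
    (x := Ideal.Quotient.mk Q f)
    ⟨Ideal.mem_map_of_mem _ hf, by simpa [Ideal.Quotient.eq_zero_iff_mem] using hfQ⟩ (hintegral f)
  refine hlt.not_ge fun h hh => ?_
  rw [Ideal.mem_comap, halg, ← Ideal.mem_comap, Ideal.comap_map_mk hle, mem_lineIdeal] at hh
  have hpi : Polynomial.C (p i) * Polynomial.C (p i)⁻¹ = 1 := by
    rw [← Polynomial.C_mul, mul_inv_cancel₀ hi, Polynomial.C_1]
  let ρ : ArcRing →ₐ[ℂ] Polynomial ℂ := aeval fun _ => Polynomial.C (p i)⁻¹ * Polynomial.X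
  have hcomp : (ρ.toRingHom.comp ((restrictLine p).toRingHom.comp (map (algebraMap ℚ ℂ)))).comp
      (Polynomial.aeval (X i : MvPolynomial (Fin 3) ℚ)).toRingHom =
      Polynomial.mapRingHom (algebraMap ℚ ℂ) := by
    ext r <;> simp [restrictLine, ρ, ← mul_assoc, hpi]
  have hmap : h.map (algebraMap ℚ ℂ) = 0 :=
    (DFunLike.congr_fun hcomp h).symm.trans ((congrArg ρ hh).trans (map_zero ρ))
  rw [(Polynomial.map_eq_zero _).1 hmap]
  exact Ideal.zero_mem _

theorem lineIdeal_isAssociatedPrime {p : Fin 3 → ℂ} (hp : IsFermatPoint p) :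
    IsAssociatedPrime (lineIdeal p) (MvPolynomial (Fin 3) ℚ ⧸ fermatIdeal) := by
  refine Module.associatedPrimes.minimalPrimes_annihilator_subset_associatedPrimes _ _ ?_
  rw [Ideal.annihilator_quotient]
  exact ⟨⟨inferInstance, fermatIdeal_le_lineIdeal hp⟩, fun Q hQ hle =>
    have := hQ.1
    lineIdeal_le_of_le hp.ne_zero hQ.2 hle⟩

theorem X_pow_dvd_germ_of_mem_symbolicPower {f : MvPolynomial (Fin 3) ℚ} {m : ℕ}
    (hf : f ∈ symbolicPower fermatIdeal m) {p : Fin 3 → ℂ} (hp : IsFermatPoint p) :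
    Polynomial.X ^ m ∣ germ p (map (algebraMap ℚ ℂ) f) := by
  obtain ⟨s, hs, hsf⟩ := mem_symbolicPower_iff.1 hf _ (lineIdeal_isAssociatedPrime hp)
  let φ : MvPolynomial (Fin 3) ℚ →+* Polynomial ArcRing :=
    (germ p).toRingHom.comp (map (algebraMap ℚ ℂ))
  have hφ : ∀ g, Polynomial.X ∣ φ g ↔ g ∈ lineIdeal p := fun g => by
    rw [Polynomial.X_dvd_iff, mem_lineIdeal, ← coeff_zero_germ]
    rfl
  have hle : fermatIdeal ^ m ≤ (Ideal.span {Polynomial.X ^ m}).comap φ := by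
    rw [← Ideal.span_singleton_pow]
    refine (Ideal.pow_right_mono ?_ m).trans (Ideal.le_comap_pow φ m)
    intro g hg
    rw [Ideal.mem_comap, Ideal.mem_span_singleton, hφ]
    exact fermatIdeal_le_lineIdeal hp hg
  have h := hle hsf
  rw [Ideal.mem_comap, Ideal.mem_span_singleton, map_mul] at h
  exact Polynomial.prime_X.pow_dvd_of_dvd_mul_left m (mt (hφ s).1 hs) h

end Points

section Lines

theorem Fin.eq_or_eq_add_one_or_eq_add_two :
    ∀ i k : Fin 3, i = k ∨ i = k + 1 ∨ i = k + 2 := by decide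

theorem Fin.add_one_ne_self_of_three : ∀ k : Fin 3, k + 1 ≠ k := by decide

theorem Fin.add_two_ne_self_of_three : ∀ k : Fin 3, k + 2 ≠ k := by decide

theorem Fin.add_two_ne_add_one_of_three : ∀ k : Fin 3, k + 2 ≠ k + 1 := by decide

theorem Fin.add_one_add_one_of_three : ∀ k : Fin 3, k + 1 + 1 = k + 2 := by decide

theorem Fin.add_two_add_one_of_three : ∀ k : Fin 3, k + 2 + 1 = k := by decide

theorem Finset.prod_dvd_of_forall_map_eq_zero {ι R D : Type*} [CommRing R] [CommRing D]
    [IsDomain D] (S : Finset ι) (L : ι → R) (φ : ι → R →+* D)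
    (hker : ∀ i F, φ i F = 0 → L i ∣ F) (hne : ∀ i j, i ≠ j → φ i (L j) ≠ 0) {F : R}
    (hF : ∀ i, φ i F = 0) : ∏ i ∈ S, L i ∣ F := by
  classical
  induction S using Finset.induction_on with
  | empty => simp
  | insert i S hi ih =>
    obtain ⟨G, rfl⟩ := ih
    have h := hF i
    rw [map_mul, map_prod, mul_eq_zero] at h
    have hG := hker i G (h.resolve_left (Finset.prod_ne_zero_iff.2 fun j hj =>
      hne i j fun hij => hi (hij ▸ hj)))
    rw [Finset.prod_insert hi, mul_comm]
    exact mul_dvd_mul_left _ hG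

/-- The linear form `X k - ζ X (k + 1)`. -/
noncomputable def linearForm (ζ : ℂ) (k : Fin 3) : MvPolynomial (Fin 3) ℂ :=
  X k - C ζ * X (k + 1)

/-- The parametrization of the plane `X k = ζ X (k + 1)` by `ℂ[s][t]`. -/
noncomputable def planeParam (ζ : ℂ) (k : Fin 3) :
    MvPolynomial (Fin 3) ℂ →ₐ[ℂ] Polynomial (Polynomial ℂ) :=
  aeval fun i => if i = k then Polynomial.C (Polynomial.C ζ) * Polynomial.X
    else if i = k + 1 then Polynomial.X else Polynomial.C Polynomial.X

theorem planeParam_X (ζ : ℂ) (k i : Fin 3) : planeParam ζ k (X i) =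
    if i = k then Polynomial.C (Polynomial.C ζ) * Polynomial.X
    else if i = k + 1 then Polynomial.X else Polynomial.C Polynomial.X :=
  aeval_X _ _

theorem planeParam_C (ζ : ℂ) (k : Fin 3) (c : ℂ) : planeParam ζ k (C c) =
    Polynomial.C (Polynomial.C c) :=
  aeval_C _ _

theorem linearForm_dvd_of_planeParam_eq_zero {ζ : ℂ} {k : Fin 3} {F : MvPolynomial (Fin 3) ℂ}
    (h : planeParam ζ k F = 0) : linearForm ζ k ∣ F := by
  let ρ : Polynomial (Polynomial ℂ) →+* MvPolynomial (Fin 3) ℂ :=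
    Polynomial.eval₂RingHom (Polynomial.eval₂RingHom C (X (k + 2))) (X (k + 1))
  let q := Ideal.Quotient.mk (Ideal.span {linearForm ζ k})
  have hcomp : (q.comp ρ).comp (planeParam ζ k).toRingHom = q := by
    have hq : q (X k) = q (C ζ * X (k + 1)) :=
      Ideal.Quotient.eq.2 (Ideal.mem_span_singleton_self _)
    refine MvPolynomial.ringHom_ext (fun c => ?_) (fun i => ?_)
    · simp [ρ]
    · have h1 := Fin.add_one_ne_self_of_three k
      have h2 := Fin.add_two_ne_self_of_three k
      have h3 := Fin.add_two_ne_add_one_of_three k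
      rcases Fin.eq_or_eq_add_one_or_eq_add_two i k with rfl | rfl | rfl
      · simp [planeParam_X, ρ, hq]
      · simp [planeParam_X, ρ, h1]
      · simp [planeParam_X, ρ, h2, h3]
  rw [← Ideal.mem_span_singleton, ← Ideal.Quotient.eq_zero_iff_mem]
  have := DFunLike.congr_fun hcomp F
  exact this.symm.trans ((congrArg (q.comp ρ) h).trans (map_zero _))

theorem planeParam_linearForm_ne_zero {ζ ζ' : ℂ} {k k' : Fin 3}
    (h : k = k' → ζ ≠ ζ') : planeParam ζ k (linearForm ζ' k') ≠ 0 := by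
  intro h0
  rw [linearForm, map_sub, map_mul, planeParam_C, planeParam_X, planeParam_X] at h0
  have hev : ∀ s t : ℂ, _ := fun s t =>
    congrArg (fun F => Polynomial.eval s (Polynomial.eval (Polynomial.C t) F)) h0
  have h1 := Fin.add_one_ne_self_of_three k
  have h2 := Fin.add_two_ne_self_of_three k
  have h3 := Fin.add_two_ne_add_one_of_three k
  have h4 := Fin.add_one_add_one_of_three k
  have h5 := Fin.add_two_add_one_of_three k
  rcases Fin.eq_or_eq_add_one_or_eq_add_two k' k with rfl | rfl | rfl
  · refine h rfl (sub_eq_zero.1 ?_)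
    simpa [h1] using hev 0 1
  · simpa [h1, h4, h2, h3] using hev 0 1
  · simpa [h5, h2, h3] using hev 1 0

theorem pow_dvd_planeParam {F : MvPolynomial (Fin 3) ℂ} {m : ℕ}
    (hF : ∀ p, IsFermatPoint p → Polynomial.X ^ m ∣ germ p F) {ζ η : ℂ} (hζ : ζ ^ 3 = 1)
    (hη : η = 0 ∨ η ^ 3 = 1) (k : Fin 3) :
    (Polynomial.X - Polynomial.C (Polynomial.C η * Polynomial.X)) ^ m ∣ planeParam ζ k F := by
  let p : Fin 3 → ℂ := fun i => if i = k then ζ * η else if i = k + 1 then η else 1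
  let w : Fin 3 → ℂ := fun i => if i = k then ζ else if i = k + 1 then 1 else 0
  have h1 := Fin.add_one_ne_self_of_three k
  have h2 := Fin.add_two_ne_self_of_three k
  have h3 := Fin.add_two_ne_add_one_of_three k
  have hp : IsFermatPoint p := by
    refine ⟨Function.ne_iff.2 ⟨k + 2, by simp [p, h2, h3]⟩, ?_, ?_, ?_⟩ <;>
    rcases hη with rfl | hη <;> fin_cases k <;> simp [p, mul_pow, *]
  let σ : Polynomial ArcRing →+* Polynomial (Polynomial ℂ) :=
    Polynomial.eval₂RingHom
      (eval₂Hom (Polynomial.C.comp Polynomial.C) fun i : Option (Fin 3) =>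
        i.elim (Polynomial.C Polynomial.X) fun i => Polynomial.C (Polynomial.C (w i)))
      (Polynomial.X - Polynomial.C (Polynomial.C η * Polynomial.X))
  have hcomp : σ.comp (germ p).toRingHom = (planeParam ζ k).toRingHom := by
    refine MvPolynomial.ringHom_ext (fun c => ?_) (fun i => ?_)
    · simp [σ, germ, Polynomial.algebraMap_apply, MvPolynomial.algebraMap_eq]
    · rcases Fin.eq_or_eq_add_one_or_eq_add_two i k with rfl | rfl | rfl
      · simp [planeParam_X, σ, germ_X, p, w]
        ring
      · simp [planeParam_X, σ, germ_X, p, w, h1]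
      · simp [planeParam_X, σ, germ_X, p, w, h2, h3]
  have h := map_dvd σ (hF p hp)
  rw [map_pow] at h
  have hX : σ Polynomial.X = Polynomial.X - Polynomial.C (Polynomial.C η * Polynomial.X) := by
    simp [σ]
  rw [hX] at h
  exact h.trans (dvd_of_eq (DFunLike.congr_fun hcomp F))

theorem natDegree_planeParam_le (ζ : ℂ) (k : Fin 3) (F : MvPolynomial (Fin 3) ℂ) :
    (planeParam ζ k F).natDegree ≤ F.totalDegree := by
  let f : Fin 3 → Polynomial (Polynomial ℂ) := fun i =>
    if i = k then Polynomial.C (Polynomial.C ζ) * Polynomial.X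
    else if i = k + 1 then Polynomial.X else Polynomial.C Polynomial.X
  have hf : ∀ i, (f i).natDegree ≤ 1 := fun i => by
    dsimp only [f]
    split_ifs
    · exact (Polynomial.natDegree_C_mul_le _ _).trans Polynomial.natDegree_X_le
    · exact Polynomial.natDegree_X_le
    · exact (Polynomial.natDegree_C _).trans_le zero_le_one
  have h : aeval f (map (algebraMap ℂ (Polynomial ℂ)) F) = planeParam ζ k F :=
    aeval_map_algebraMap (Polynomial ℂ) f F
  have hdeg := aeval_natDegree_le (map (algebraMap ℂ (Polynomial ℂ)) F)
    (Finset.sup_mono (support_map_subset _ F)) f hf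
  rwa [h, mul_one] at hdeg

theorem planeParam_eq_zero {F : MvPolynomial (Fin 3) ℂ} {m : ℕ}
    (hF : ∀ p, IsFermatPoint p → Polynomial.X ^ m ∣ germ p F) (hm : F.totalDegree < 4 * m)
    {ζ : ℂ} (hζ : ζ ^ 3 = 1) (k : Fin 3) : planeParam ζ k F = 0 := by
  classical
  by_contra hne
  let f : ℂ → Polynomial ℂ := fun η => Polynomial.C η * Polynomial.X
  have hf : Function.Injective f := fun a b h => by
    simpa [f] using congrArg (Polynomial.eval 1) h
  let E : Finset ℂ := insert 0 (Polynomial.nthRootsFinset 3 (1 : ℂ))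
  have hE : E.card = 4 := by
    rw [Finset.card_insert_of_notMem (by simp [Polynomial.mem_nthRootsFinset]),
      (Complex.isPrimitiveRoot_exp 3 (by norm_num)).card_nthRootsFinset]
  have hle : m • (E.image f).val ≤ (planeParam ζ k F).roots := by
    rw [Multiset.le_iff_count]
    intro a
    rw [Multiset.count_nsmul, Polynomial.count_roots]
    by_cases ha : a ∈ E.image f
    · rw [Multiset.count_eq_one_of_mem (E.image f).nodup ha, mul_one,
        Polynomial.le_rootMultiplicity_iff hne]
      obtain ⟨η, hη, rfl⟩ := Finset.mem_image.1 ha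
      refine pow_dvd_planeParam hF hζ ?_ k
      simpa [E, Polynomial.mem_nthRootsFinset] using hη
    · rw [Multiset.count_eq_zero_of_notMem ha, mul_zero]
      exact Nat.zero_le _
  have hcard := (Multiset.card_le_card hle).trans (Polynomial.card_roots' _)
  rw [Multiset.card_nsmul, Finset.card_val, Finset.card_image_of_injective _ hf, hE] at hcard
  have hdeg := natDegree_planeParam_le ζ k F
  lia

theorem nineLines_dvd {F : MvPolynomial (Fin 3) ℂ} {m : ℕ}
    (hF : ∀ p, IsFermatPoint p → Polynomial.X ^ m ∣ germ p F) (hm : F.totalDegree < 4 * m) :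
    nineLines ℂ ∣ F := by
  obtain ⟨ω, hω⟩ : ∃ ω : ℂ, IsPrimitiveRoot ω 3 :=
    ⟨_, Complex.isPrimitiveRoot_exp 3 (by norm_num)⟩
  have hpow : ∀ a : Fin 3, (ω ^ (a : ℕ)) ^ 3 = 1 := fun a => by
    rw [← pow_mul, mul_comm, pow_mul, hω.pow_eq_one, one_pow]
  have hprod : ∏ i : Fin 3 × Fin 3, linearForm (ω ^ (i.2 : ℕ)) i.1 = nineLines ℂ := by
    have hsum : 1 + ω + ω ^ 2 = 0 := by
      simpa [Finset.sum_range_succ] using hω.geom_sum_eq_zero (by norm_num)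
    have hsum' : 1 + C ω + C ω ^ 2 = (0 : MvPolynomial (Fin 3) ℂ) := by
      simpa using congrArg (C (σ := Fin 3)) hsum
    have key : ∀ k : Fin 3, ∏ a : Fin 3, linearForm (ω ^ (a : ℕ)) k = X k ^ 3 - X (k + 1) ^ 3 := by
      intro k
      simp only [Fin.prod_univ_three, linearForm, Fin.val_zero, Fin.val_one, Fin.val_two, C_pow]
      linear_combination (X k - X (k + 1)) *
        (-X k * X (k + 1) + (C ω - 1) * X (k + 1) ^ 2) * hsum'
    rw [Fintype.prod_prod_type, Fin.prod_univ_three, key, key, key, nineLines]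
    simp only [zero_add, Fin.reduceAdd]
  let φ : Fin 3 × Fin 3 → MvPolynomial (Fin 3) ℂ →+* Polynomial (Polynomial ℂ) :=
    fun i => (planeParam (ω ^ (i.2 : ℕ)) i.1 : MvPolynomial (Fin 3) ℂ →+* _)
  have hne : ∀ i j : Fin 3 × Fin 3, i ≠ j → φ i (linearForm (ω ^ (j.2 : ℕ)) j.1) ≠ 0 :=
    fun i j hij => planeParam_linearForm_ne_zero fun h1 h2 =>
      hij (Prod.ext h1 (Fin.ext (hω.pow_inj i.2.2 j.2.2 h2)))
  rw [← hprod]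
  exact Finset.prod_dvd_of_forall_map_eq_zero _ _ φ
    (fun i G h => linearForm_dvd_of_planeParam_eq_zero h) hne
    (fun i => planeParam_eq_zero hF hm (hpow i.2) i.1)

end Lines

section Order

theorem Polynomial.emultiplicity_X_pow_mul {R : Type*} [CommRing R] [IsDomain R]
    {v : Polynomial R} (hv : v.coeff 0 ≠ 0) (n : ℕ) :
    emultiplicity Polynomial.X (Polynomial.X ^ n * v) = n := by
  rw [emultiplicity_mul Polynomial.prime_X, emultiplicity_pow_self_of_prime Polynomial.prime_X,
    emultiplicity_eq_zero.2 (mt Polynomial.X_dvd_iff.1 hv), add_zero]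

theorem emultiplicity_germ_of_ne {p : Fin 3 → ℂ} {i j : Fin 3} (h : p i ^ 3 ≠ p j ^ 3) :
    emultiplicity Polynomial.X (germ p (X i ^ 3 - X j ^ 3)) = 0 := by
  rw [emultiplicity_eq_zero, Polynomial.X_dvd_iff, coeff_zero_germ]
  intro h0
  refine sub_ne_zero.2 h ?_
  simpa [restrictLine] using congrArg (eval fun _ => 1) h0

theorem emultiplicity_germ_of_eq {p : Fin 3 → ℂ} {i j : Fin 3} (hij : i ≠ j)
    (h : p i ^ 3 = p j ^ 3) (hi : p i ≠ 0) :
    emultiplicity Polynomial.X (germ p (X i ^ 3 - X j ^ 3)) = 1 := by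
  let a : Fin 3 → Polynomial ArcRing := fun k => Polynomial.C (C (p k) * X none)
  let w : Fin 3 → Polynomial ArcRing := fun k => Polynomial.C (X (some k))
  have ha : a i ^ 3 = a j ^ 3 := by
    simp only [a, ← map_pow, mul_pow, h]
  have hgerm : germ p (X i ^ 3 - X j ^ 3) = Polynomial.X ^ 1 *
      (3 * (a i ^ 2 * w i - a j ^ 2 * w j) + Polynomial.X *
        (3 * (a i * w i ^ 2 - a j * w j ^ 2) + Polynomial.X * (w i ^ 3 - w j ^ 3))) := by
    simp only [map_sub, map_pow, germ_X]
    linear_combination ha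
  rw [hgerm, Polynomial.emultiplicity_X_pow_mul _ 1, Nat.cast_one]
  intro h0
  have h1 := congrArg (eval fun k : Option (Fin 3) => if k = none ∨ k = some i then 1 else 0) h0
  simp [a, w, Polynomial.coeff_zero_eq_eval_zero, hij.symm, hi] at h1

theorem emultiplicity_germ_of_eq_zero {p : Fin 3 → ℂ} {i j : Fin 3} (hij : i ≠ j)
    (hi : p i = 0) (hj : p j = 0) :
    emultiplicity Polynomial.X (germ p (X i ^ 3 - X j ^ 3)) = 3 := by
  have hgerm : germ p (X i ^ 3 - X j ^ 3) = Polynomial.X ^ 3 *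
      Polynomial.C (X (some i) ^ 3 - X (some j) ^ 3) := by
    simp only [map_sub, map_pow, germ_X, hi, hj, C_0, zero_mul, Polynomial.C_0]
    ring
  rw [hgerm, Polynomial.emultiplicity_X_pow_mul _ 3, Nat.cast_ofNat]
  rw [Polynomial.coeff_C_zero]
  intro h0
  have h1 := congrArg (eval fun k : Option (Fin 3) => if k = some i then 1 else 0) h0
  simp [hij.symm] at h1

theorem emultiplicity_germ_nineLines {p : Fin 3 → ℂ} (hp : IsFermatPoint p) :
    emultiplicity Polynomial.X (germ p (nineLines ℂ)) = 3 := by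
  obtain ⟨hne, e0, e1, e2⟩ := hp
  rw [nineLines, map_mul, map_mul, emultiplicity_mul Polynomial.prime_X,
    emultiplicity_mul Polynomial.prime_X]
  by_cases h0 : p 0 = 0 <;> by_cases h1 : p 1 = 0 <;> by_cases h2 : p 2 = 0
  · exact absurd (_root_.funext fun i => by fin_cases i <;> assumption) hne
  · rw [emultiplicity_germ_of_eq_zero (by decide) h0 h1,
      emultiplicity_germ_of_ne (fun h => h2 (by simpa [h1] using h.symm)),
      emultiplicity_germ_of_ne (fun h => h2 (by simpa [h0] using h))]
    rfl
  · rw [emultiplicity_germ_of_eq_zero (i := 2) (by decide) h2 h0,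
      emultiplicity_germ_of_ne (fun h => h1 (by simpa [h0] using h.symm)),
      emultiplicity_germ_of_ne (fun h => h1 (by simpa [h2] using h))]
    rfl
  · simp [h0, h1, h2] at e1
  · rw [emultiplicity_germ_of_eq_zero (i := 1) (by decide) h1 h2,
      emultiplicity_germ_of_ne (fun h => h0 (by simpa [h1] using h)),
      emultiplicity_germ_of_ne (fun h => h0 (by simpa [h2] using h.symm))]
    rfl
  · simp [h0, h1, h2] at e2
  · simp [h0, h1, h2] at e0
  · rw [emultiplicity_germ_of_eq (by decide)
        (sub_eq_zero.1 ((mul_eq_zero.1 e2).resolve_left h2)) h0,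
      emultiplicity_germ_of_eq (by decide)
        (sub_eq_zero.1 ((mul_eq_zero.1 e0).resolve_left h0)) h1,
      emultiplicity_germ_of_eq (by decide)
        (sub_eq_zero.1 ((mul_eq_zero.1 e1).resolve_left h1)) h2]
    rfl

theorem X_pow_sub_three_dvd_germ {p : Fin 3 → ℂ} (hp : IsFermatPoint p)
    {G : MvPolynomial (Fin 3) ℂ} {m : ℕ}
    (h : Polynomial.X ^ m ∣ germ p (nineLines ℂ * G)) :
    Polynomial.X ^ (m - 3) ∣ germ p G := by
  rw [pow_dvd_iff_le_emultiplicity] at h ⊢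
  rw [map_mul, emultiplicity_mul Polynomial.prime_X, emultiplicity_germ_nineLines hp] at h
  rw [ENat.natCast_sub]
  exact tsub_le_iff_left.2 h

end Order

section Degree

theorem nineLines_isHomogeneous (K : Type*) [CommRing K] : (nineLines K).IsHomogeneous 9 := by
  have h : ∀ i j : Fin 3, (X i ^ 3 - X j ^ 3 : MvPolynomial (Fin 3) K).IsHomogeneous 3 :=
    fun i j => (isHomogeneous_X_pow i 3).sub (isHomogeneous_X_pow j 3)
  exact ((h 0 1).mul (h 1 2)).mul (h 2 0)

theorem nineLines_ne_zero (K : Type*) [Field K] [CharZero K] : nineLines K ≠ 0 := by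
  intro h
  have := congrArg (eval fun i : Fin 3 => ((i : ℕ) : K)) h
  norm_num [nineLines] at this

theorem three_mul_le_totalDegree {m : ℕ} {F : MvPolynomial (Fin 3) ℂ} (hF0 : F ≠ 0)
    (hF : ∀ p, IsFermatPoint p → Polynomial.X ^ m ∣ germ p F) : 3 * m ≤ F.totalDegree := by
  induction m using Nat.strong_induction_on generalizing F with
  | _ m ih =>
    by_contra! hlt
    obtain ⟨G, rfl⟩ := nineLines_dvd hF (by lia)
    have hN := nineLines_ne_zero ℂ
    have hG := right_ne_zero_of_mul hF0
    have := ih (m - 3) (by lia) hG fun p hp => X_pow_sub_three_dvd_germ hp (hF p hp)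
    rw [totalDegree_mul_of_isDomain hN hG, (nineLines_isHomogeneous ℂ).totalDegree hN] at hlt
    lia

theorem three_mul_le_initialDegree_symbolicPower (m : ℕ) :
    3 * m ≤ initialDegree (symbolicPower fermatIdeal m) ∧
      initialDegree (symbolicPower fermatIdeal m) ≤ 3 * m + 6 := by
  have hmem : 9 * ((m + 2) / 3) ∈
      {d | ∃ f ∈ symbolicPower fermatIdeal m, f ≠ 0 ∧ f.IsHomogeneous d} :=
    ⟨nineLines ℚ ^ ((m + 2) / 3),
      symbolicPower_anti _ (by lia) (nineLines_pow_mem_symbolicPower _),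
      pow_ne_zero _ (nineLines_ne_zero ℚ), (nineLines_isHomogeneous ℚ).pow _⟩
  refine ⟨?_, (Nat.sInf_le hmem).trans (by lia)⟩
  obtain ⟨f, hf, hf0, hd⟩ := Nat.sInf_mem ⟨_, hmem⟩
  have hinj := map_injective (σ := Fin 3) (algebraMap ℚ ℂ) (algebraMap ℚ ℂ).injective
  refine (three_mul_le_totalDegree ((map_ne_zero_iff _ hinj).2 hf0) fun p hp =>
    X_pow_dvd_germ_of_mem_symbolicPower hf hp).trans ?_
  exact (hd.map _).totalDegree_le

end Degree

open Filter in
/-- The Waldschmidt constant of `I = (x(y³ − z³), y(z³ − x³), z(x³ − y³)) ⊆ ℚ[x,y,z]`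
equals `3`. -/
theorem waldschmidt_fermatIdeal :
    Tendsto (fun m : ℕ => (initialDegree (symbolicPower fermatIdeal m) : ℝ) / m) atTop
      (nhds 3) := by
  refine tendsto_of_tendsto_of_tendsto_of_le_of_le' (g := fun _ => 3)
    (h := fun m : ℕ => 3 + 6 / (m : ℝ)) tendsto_const_nhds ?_ ?_ ?_
  · simpa using (tendsto_const_div_atTop_nhds_zero_nat (6 : ℝ)).const_add 3
  · filter_upwards [eventually_gt_atTop 0] with m hm
    rw [le_div_iff₀ (by exact_mod_cast hm)]
    exact_mod_cast (three_mul_le_initialDegree_symbolicPower m).1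
  · filter_upwards [eventually_gt_atTop 0] with m hm
    have hm' : (0 : ℝ) < m := by exact_mod_cast hm
    rw [div_le_iff₀ hm', add_mul, div_mul_cancel₀ _ hm'.ne']
    exact_mod_cast (three_mul_le_initialDegree_symbolicPower m).2
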